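/- arXiv:math/9905010 — 2 statements merged into one kernel-verified Lean document; each statement's English description precedes it below -/
import Mathlib

section
/- If β ∈ Φ is a dominant root ((β, α_j) ≥ 0 for all 1 ≤ j ≤ r) with β ≠ θ, then (β, β + 2ρ) < (θ, θ + 2ρ); moreover (θ, θ + 2ρ) = 2h. -/
open scoped RealInnerProductSpace

noncomputable section

/-- An irreducible reduced crystallographic root system in a finite-dimensional real
inner product space, normalized so that long roots have squared length `2`, together
with a chosen base `α`, the half-sum `ρ` of the positive roots, the highest root `θ`,
and the fundamental weights `fw`. -/
structure RootSystemData (E : Type) [NormedAddCommGroup E] [InnerProductSpace ℝ E]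
    [FiniteDimensional ℝ E] : Type where
  Φ : Finset E
  r : ℕ
  α : Fin r → E
  ρ : E
  θ : E
  fw : Fin r → E
  nonzero : ∀ β ∈ Φ, β ≠ (0 : E)
  spans : Submodule.span ℝ (Φ : Set E) = ⊤
  reflect_mem : ∀ β ∈ Φ, ∀ γ ∈ Φ, γ - (2 * ⟪γ, β⟫ / ⟪β, β⟫) • β ∈ Φ
  integral : ∀ β ∈ Φ, ∀ γ ∈ Φ, ∃ n : ℤ, 2 * ⟪γ, β⟫ / ⟪β, β⟫ = (n : ℝ)
  reduced : ∀ β ∈ Φ, ∀ t : ℝ, t • β ∈ Φ → t = 1 ∨ t = -1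
  irred : ¬ ∃ Φ₁ Φ₂ : Finset E, Φ₁.Nonempty ∧ Φ₂.Nonempty ∧ Disjoint Φ₁ Φ₂ ∧
      (∀ β, β ∈ Φ ↔ β ∈ Φ₁ ∨ β ∈ Φ₂) ∧ ∀ a ∈ Φ₁, ∀ b ∈ Φ₂, ⟪a, b⟫ = 0
  long_le : ∀ β ∈ Φ, ⟪β, β⟫ ≤ 2
  long_exists : ∃ β ∈ Φ, ⟪β, β⟫ = 2
  base_mem : ∀ i, α i ∈ Φ
  base_indep : LinearIndependent ℝ α
  base_spans : Submodule.span ℝ (Set.range α) = ⊤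
  base_coeffs : ∀ β ∈ Φ, ∃ c : Fin r → ℤ, β = ∑ i, (c i : ℝ) • α i ∧
      ((∀ i, 0 ≤ c i) ∨ (∀ i, c i ≤ 0))
  ρ_def : ∃ P : Finset E,
      (∀ β, β ∈ P ↔ β ∈ Φ ∧ ∃ c : Fin r → ℕ, β = ∑ i, (c i : ℝ) • α i) ∧
      ρ = (2 : ℝ)⁻¹ • ∑ β ∈ P, β
  θ_mem : θ ∈ Φ
  θ_pos : ∃ c : Fin r → ℕ, θ = ∑ i, (c i : ℝ) • α i
  θ_highest : ∀ β ∈ Φ, ∃ c : Fin r → ℝ, (∀ i, 0 ≤ c i) ∧ θ - β = ∑ i, c i • α i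
  fw_def : ∀ i j, ⟪fw i, α j⟫ = if i = j then ⟪α j, α j⟫ / 2 else 0

variable {E : Type} [NormedAddCommGroup E] [InnerProductSpace ℝ E] [FiniteDimensional ℝ E]


namespace RootSystemData

lemma inner_self_pos' (D : RootSystemData E) {γ : E} (h : γ ∈ D.Φ) : 0 < ⟪γ, γ⟫ :=
  real_inner_self_pos.2 (D.nonzero γ h)

lemma coeff_unique (D : RootSystemData E) {c d : Fin D.r → ℝ}
    (h : ∑ i, c i • D.α i = ∑ i, d i • D.α i) (i : Fin D.r) : c i = d i := by
  have h0 : ∑ i, (c i - d i) • D.α i = 0 := by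
    simp only [sub_smul, Finset.sum_sub_distrib, h, sub_self]
  have := (Fintype.linearIndependent_iff.1 D.base_indep) (fun i => c i - d i) h0 i
  simpa [sub_eq_zero] using this

/-- The simple reflection preserves positivity of every positive root but the simple one. -/
lemma refl_pos (D : RootSystemData E) (j : Fin D.r) {β : E} (hβ : β ∈ D.Φ)
    (hpos : ∃ c : Fin D.r → ℕ, β = ∑ i, (c i : ℝ) • D.α i) (hne : β ≠ D.α j) (t : ℝ)
    (hr : β - t • D.α j ∈ D.Φ) :
    ∃ c : Fin D.r → ℕ, β - t • D.α j = ∑ i, (c i : ℝ) • D.α i := by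
  obtain ⟨c, hc⟩ := hpos
  obtain ⟨d, hd, hs⟩ := D.base_coeffs _ hr
  have key : ∀ i, i ≠ j → (c i : ℝ) = d i := by
    intro i hij
    have h1 : ∑ i, ((c i : ℝ) - if i = j then t else 0) • D.α i
        = ∑ i, (d i : ℝ) • D.α i := by
      rw [← hd, hc]
      simp [sub_smul, Finset.sum_sub_distrib, ite_smul]
    have := D.coeff_unique h1 i
    simpa [hij] using this
  rcases hs with hs | hs
  · refine ⟨fun i => (d i).toNat, ?_⟩
    rw [hd]
    refine Finset.sum_congr rfl fun i _ => ?_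
    have : (((d i).toNat : ℤ) : ℝ) = (d i : ℝ) := by rw [Int.toNat_of_nonneg (hs i)]
    rw [← this, Int.cast_natCast]
  · exfalso
    have hz : ∀ i, i ≠ j → c i = 0 := by
      intro i hij
      have h1 := key i hij
      have h2 : (c i : ℤ) = d i := by exact_mod_cast h1
      have := hs i
      omega
    have hb : β = (c j : ℝ) • D.α j := by
      rw [hc]
      refine Finset.sum_eq_single j (fun i _ hij => by simp [hz i hij]) (by simp)
    have hm := hβ
    rw [hb] at hm
    rcases D.reduced _ (D.base_mem j) _ hm with h | h
    · exact hne (by rw [hb, h, one_smul])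
    · have : (0 : ℝ) ≤ c j := Nat.cast_nonneg _
      linarith

lemma inner_rho (D : RootSystemData E) (j : Fin D.r) : 0 < ⟪D.α j, D.ρ⟫ := by
  classical
  obtain ⟨P, hP, hρ⟩ := D.ρ_def
  have hjj := D.inner_self_pos' (D.base_mem j)
  have hjP : D.α j ∈ P := by
    rw [hP]
    exact ⟨D.base_mem j, fun i => if i = j then 1 else 0, by simp [ite_smul]⟩
  have hinner : ∀ b : E, ⟪D.α j, b - (2 * ⟪b, D.α j⟫ / ⟪D.α j, D.α j⟫) • D.α j⟫
      = - ⟪D.α j, b⟫ := by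
    intro b
    rw [inner_sub_right, inner_smul_right, real_inner_comm b (D.α j)]
    field_simp
    ring
  have hsum : ∑ b ∈ P.erase (D.α j), ⟪D.α j, b⟫ = 0 := by
    refine Finset.sum_involution
      (fun b _ => b - (2 * ⟪b, D.α j⟫ / ⟪D.α j, D.α j⟫) • D.α j) ?_ ?_ ?_ ?_
    · intro b hb
      rw [hinner]; ring
    · intro b hb h0 he
      have := hinner b
      rw [he] at this
      exact h0 (by linarith)
    · intro b hb
      obtain ⟨hbne, hbP⟩ := Finset.mem_erase.1 hb
      obtain ⟨hbΦ, hbpos⟩ := (hP b).1 hbP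
      have hr := D.reflect_mem _ (D.base_mem j) _ hbΦ
      refine Finset.mem_erase.2 ⟨?_, (hP _).2 ⟨hr, D.refl_pos j hbΦ hbpos hbne _ hr⟩⟩
      intro he
      set t := 2 * ⟪b, D.α j⟫ / ⟪D.α j, D.α j⟫ with ht
      have hb1 : b = (1 + t) • D.α j := by
        rw [add_smul, one_smul, ← sub_eq_iff_eq_add]; exact he
      have hi := hinner b
      rw [← ht, he] at hi
      rcases D.reduced _ (D.base_mem j) (1 + t) (hb1 ▸ hbΦ) with h | h
      · exact hbne (by rw [hb1, h, one_smul])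
      · obtain ⟨c, hc⟩ := hbpos
        have h1 : ∑ i, (c i : ℝ) • D.α i = ∑ i, (if i = j then (-1 : ℝ) else 0) • D.α i := by
          rw [← hc, hb1, h]; simp [ite_smul]
        have := D.coeff_unique h1 j
        simp only [if_true] at this
        have h2 : (0 : ℝ) ≤ c j := Nat.cast_nonneg _
        linarith
    · intro b hb
      have h1 := hinner b
      rw [real_inner_comm] at h1
      simp only [h1, real_inner_comm b (D.α j)]
      rw [sub_sub, ← add_smul]
      convert sub_zero b
      rw [smul_eq_zero]; left; ring
  rw [hρ, inner_smul_right, inner_sum, ← Finset.add_sum_erase _ _ hjP, hsum]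
  linarith

lemma theta_dom (D : RootSystemData E) (j : Fin D.r) : 0 ≤ ⟪D.θ, D.α j⟫ := by
  by_contra hlt
  push Not at hlt
  have hjj := D.inner_self_pos' (D.base_mem j)
  have hr := D.reflect_mem _ (D.base_mem j) _ D.θ_mem
  have ht : 2 * ⟪D.θ, D.α j⟫ / ⟪D.α j, D.α j⟫ < 0 := div_neg_of_neg_of_pos (by linarith) hjj
  obtain ⟨c, hc, he⟩ := D.θ_highest _ hr
  rw [sub_sub_cancel] at he
  have h1 : ∑ i, (c i) • D.α i = ∑ i, (if i = j then
      (2 * ⟪D.θ, D.α j⟫ / ⟪D.α j, D.α j⟫) else 0) • D.α i := by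
    rw [← he]; simp [ite_smul]
  have := D.coeff_unique h1 j
  simp only [if_true] at this
  linarith [hc j]

lemma theta_long (D : RootSystemData E) : ⟪D.θ, D.θ⟫ = 2 := by
  classical
  obtain ⟨g0, hg0, hg02⟩ := D.long_exists
  obtain ⟨g, hg, hmax⟩ := Finset.exists_max_image (D.Φ.filter fun x => ⟪x, x⟫ = 2)
    (fun x => ⟪x, D.ρ⟫) ⟨g0, Finset.mem_filter.2 ⟨hg0, hg02⟩⟩
  obtain ⟨hgΦ, hg2⟩ := Finset.mem_filter.1 hg
  have hdom : ∀ j, 0 ≤ ⟪g, D.α j⟫ := by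
    intro j
    by_contra hlt
    push Not at hlt
    have hjj := D.inner_self_pos' (D.base_mem j)
    have hr := D.reflect_mem _ (D.base_mem j) _ hgΦ
    have ht : 2 * ⟪g, D.α j⟫ / ⟪D.α j, D.α j⟫ < 0 := div_neg_of_neg_of_pos (by linarith) hjj
    have hl : ⟪g - (2 * ⟪g, D.α j⟫ / ⟪D.α j, D.α j⟫) • D.α j,
        g - (2 * ⟪g, D.α j⟫ / ⟪D.α j, D.α j⟫) • D.α j⟫ = 2 := by
      refine Eq.trans ?_ hg2
      simp only [inner_sub_left, inner_sub_right, real_inner_smul_left, real_inner_smul_right,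
        real_inner_comm g (D.α j)]
      field_simp
      ring
    have := hmax _ (Finset.mem_filter.2 ⟨hr, hl⟩)
    rw [inner_sub_left, real_inner_smul_left] at this
    have := mul_neg_of_neg_of_pos ht (D.inner_rho j)
    linarith
  obtain ⟨c, hc, he⟩ := D.θ_highest g hgΦ
  have h1 : 0 ≤ ⟪D.θ + g, D.θ - g⟫ := by
    rw [he, inner_sum]
    refine Finset.sum_nonneg fun i _ => ?_
    rw [inner_smul_right, inner_add_left]
    exact mul_nonneg (hc i) (add_nonneg (D.theta_dom i) (hdom i))
  rw [inner_add_left, inner_sub_right, inner_sub_right, real_inner_comm D.θ g] at h1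
  have := D.long_le _ D.θ_mem
  linarith

end RootSystemData

/-- If `β` is a dominant root different from the highest root `θ`, then
`(β, β + 2ρ) < (θ, θ + 2ρ)`; moreover `(θ, θ + 2ρ) = 2h` where `h = (ρ,θ) + 1`. -/
theorem statement8 (D : RootSystemData E) (β : E) (hβ : β ∈ D.Φ)
    (hdom : ∀ j, 0 ≤ ⟪β, D.α j⟫) (hne : β ≠ D.θ) :
    ⟪β, β + (2 : ℝ) • D.ρ⟫ < ⟪D.θ, D.θ + (2 : ℝ) • D.ρ⟫ ∧
      ⟪D.θ, D.θ + (2 : ℝ) • D.ρ⟫ = 2 * (⟪D.ρ, D.θ⟫ + 1) := by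
  have hθ := D.theta_long
  have hβ2 := D.long_le β hβ
  obtain ⟨c, hc, he⟩ := D.θ_highest β hβ
  have hlt : 0 < ⟪D.θ - β, D.ρ⟫ := by
    have hex : ∃ i, c i ≠ 0 := by
      by_contra hall
      push Not at hall
      simp only [hall, zero_smul, Finset.sum_const_zero] at he
      exact hne (sub_eq_zero.1 he).symm
    obtain ⟨i, hi⟩ := hex
    rw [he, sum_inner]
    refine Finset.sum_pos' (fun k _ => ?_) ⟨i, Finset.mem_univ _, ?_⟩
    · rw [real_inner_smul_left]; exact mul_nonneg (hc k) (D.inner_rho k).le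
    · rw [real_inner_smul_left]
      exact mul_pos (lt_of_le_of_ne (hc i) hi.symm) (D.inner_rho i)
  rw [inner_sub_left] at hlt
  rw [inner_add_right, inner_add_right, inner_smul_right, inner_smul_right, hθ,
    real_inner_comm D.θ D.ρ]
  constructor
  · have h := real_inner_comm D.θ D.ρ
    linarith
  · ring
end
end

section
/- One has 2(ρ, λ_i) = h·(λ_i, λ_i). Consequently, for every real number k, (kλ_i, kλ_i + 2ρ) = k(k + h)(λ_i, λ_i), and hence if k + h ≠ 0 then exp(πi(kλ_i, kλ_i + 2ρ)/(k + h)) = exp(πi·k(λ_i, λ_i)); in particular this number equals 1 or −1 according to whether k(λ_i, λ_i) is an even or an odd integer. -/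
open scoped RealInnerProductSpace

noncomputable section

variable {E : Type} [NormedAddCommGroup E] [InnerProductSpace ℝ E] [FiniteDimensional ℝ E]

/-- The Weyl group: the subgroup of linear automorphisms of `E` generated by the
reflections in the roots (each such reflection is automatically orthogonal). -/
def weylGroup (D : RootSystemData E) : Subgroup (E ≃ₗ[ℝ] E) :=
  Subgroup.closure {f | ∃ β ∈ D.Φ, ∀ x, f x = x - (2 * ⟪x, β⟫ / ⟪β, β⟫) • β}



theorem aux_refl_inner (x y b : E) (hb : b ≠ 0) :
    ⟪x - (2 * ⟪x, b⟫ / ⟪b, b⟫) • b, y - (2 * ⟪y, b⟫ / ⟪b, b⟫) • b⟫ = ⟪x, y⟫ := by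
  have hbb : ⟪b, b⟫ ≠ 0 := by simpa using hb
  simp only [inner_sub_left, inner_sub_right, real_inner_smul_left, real_inner_smul_right]
  rw [real_inner_comm y b]
  field_simp
  ring

theorem aux_isometry (D : RootSystemData E) (τ : E ≃ₗ[ℝ] E) (hτ : τ ∈ weylGroup D) :
    ∀ x y, ⟪τ x, τ y⟫ = ⟪x, y⟫ := by
  unfold weylGroup at hτ
  induction hτ using Subgroup.closure_induction with
  | mem f hf =>
    obtain ⟨b, hb, h⟩ := hf
    intro x y
    rw [h, h]
    exact aux_refl_inner x y b (D.nonzero b hb)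
  | one => intro x y; rfl
  | mul f g _ _ hf hg => intro x y; simp only [LinearEquiv.mul_apply, hf, hg]
  | inv f _ hf =>
    intro x y
    have e : ∀ z, f (f⁻¹ z) = z := fun z => f.apply_symm_apply z
    rw [← hf, e, e]

theorem aux_ext (D : RootSystemData E) (u : E) (h : ∀ j, ⟪u, D.α j⟫ = 0) : u = 0 := by
  have hu : u ∈ Submodule.span ℝ (Set.range D.α) := by rw [D.base_spans]; trivial
  have key : ∀ v ∈ Submodule.span ℝ (Set.range D.α), ⟪u, v⟫ = 0 := by
    intro v hv
    induction hv using Submodule.span_induction with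
    | mem x hx => obtain ⟨j, rfl⟩ := hx; exact h j
    | zero => simp
    | add x y _ _ hx hy => rw [inner_add_right, hx, hy, add_zero]
    | smul a x _ hx => rw [real_inner_smul_right, hx, mul_zero]
  exact inner_self_eq_zero.mp (key u hu)

theorem aux_refl_pos (D : RootSystemData E) (j : Fin D.r) (b : E) (hb : b ∈ D.Φ)
    (c : Fin D.r → ℕ) (hc : b = ∑ i, (c i : ℝ) • D.α i) (hne : b ≠ D.α j) :
    (b - (2 * ⟪b, D.α j⟫ / ⟪D.α j, D.α j⟫) • D.α j ∈ D.Φ ∧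
      ∃ d : Fin D.r → ℕ, b - (2 * ⟪b, D.α j⟫ / ⟪D.α j, D.α j⟫) • D.α j
        = ∑ i, (d i : ℝ) • D.α i) ∧
      b - (2 * ⟪b, D.α j⟫ / ⟪D.α j, D.α j⟫) • D.α j ≠ D.α j := by
  set t := 2 * ⟪b, D.α j⟫ / ⟪D.α j, D.α j⟫ with ht
  have hmem : b - t • D.α j ∈ D.Φ := D.reflect_mem _ (D.base_mem j) _ hb
  have hk : ∃ k, k ≠ j ∧ c k ≠ 0 := by
    by_contra hcon
    push Not at hcon
    have hb' : b = (c j : ℝ) • D.α j := by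
      rw [hc]
      apply Finset.sum_eq_single
      · intro k _ hk; rw [hcon k hk]; simp
      · simp
    rcases D.reduced _ (D.base_mem j) (c j : ℝ) (hb' ▸ hb) with h | h
    · rw [h, one_smul] at hb'; exact hne hb'
    · have : (0 : ℝ) ≤ c j := Nat.cast_nonneg _
      linarith
  obtain ⟨k, hkj, hck⟩ := hk
  have hexp : b - t • D.α j = ∑ i, ((c i : ℝ) - if i = j then t else 0) • D.α i := by
    simp only [sub_smul, Finset.sum_sub_distrib, ← hc, ite_smul, zero_smul]
    simp
  have huniq : ∀ f g : Fin D.r → ℝ, ∑ i, f i • D.α i = ∑ i, g i • D.α i → f = g := by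
    intro f g hfg
    have := Fintype.linearIndependent_iff.mp D.base_indep (fun i => f i - g i)
      (by simp only [sub_smul, Finset.sum_sub_distrib, hfg, sub_self])
    funext i
    linarith [this i]
  refine ⟨⟨hmem, ?_⟩, ?_⟩
  · obtain ⟨e, he, hs⟩ := D.base_coeffs _ hmem
    have heq := huniq _ _ (hexp.symm.trans he)
    have hek := congrFun heq k
    simp only [if_neg hkj, sub_zero] at hek
    rcases hs with hs | hs
    · refine ⟨fun i => (e i).toNat, ?_⟩
      rw [he]
      refine Finset.sum_congr rfl fun i _ => ?_
      have h1 : ((e i).toNat : ℤ) = e i := Int.toNat_of_nonneg (hs i)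
      have h2 : (((e i).toNat : ℤ) : ℝ) = (e i : ℝ) := by rw [h1]
      rw [← h2, Int.cast_natCast]
    · exfalso
      have h1 : (e k : ℝ) ≤ 0 := by exact_mod_cast hs k
      have h2 : (0 : ℝ) < c k := by exact_mod_cast Nat.pos_of_ne_zero hck
      linarith
  · intro h
    have h3 : D.α j = ∑ i, (if i = j then (1 : ℝ) else 0) • D.α i := by simp
    have heq := congrFun (huniq _ _ (hexp.symm.trans (h.trans h3))) k
    simp only [if_neg hkj, sub_zero] at heq
    exact hck (by exact_mod_cast heq)

theorem aux_rho (D : RootSystemData E) (j : Fin D.r) :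
    ⟪D.ρ, D.α j⟫ = ⟪D.α j, D.α j⟫ / 2 := by
  classical
  obtain ⟨P, hP, hρ⟩ := D.ρ_def
  have h0 : D.α j ≠ 0 := D.nonzero _ (D.base_mem j)
  have haa : ⟪D.α j, D.α j⟫ ≠ 0 := by simpa using h0
  have hjP : D.α j ∈ P := by
    rw [hP]
    exact ⟨D.base_mem j, fun i => if i = j then 1 else 0, by simp⟩
  let s : E → E := fun x => x - (2 * ⟪x, D.α j⟫ / ⟪D.α j, D.α j⟫) • D.α j
  have hsin : ∀ x, ⟪s x, D.α j⟫ = -⟪x, D.α j⟫ := by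
    intro x
    simp only [s, inner_sub_left, real_inner_smul_left]
    field_simp
    ring
  have hss : ∀ x, s (s x) = x := by
    intro x
    change s x - (2 * ⟪s x, D.α j⟫ / ⟪D.α j, D.α j⟫) • D.α j = x
    rw [hsin]
    simp only [s, mul_neg, neg_div, neg_smul, sub_neg_eq_add, sub_add_cancel]
  have hsP : ∀ x ∈ P.erase (D.α j), s x ∈ P.erase (D.α j) := by
    intro x hx
    obtain ⟨hne, hx⟩ := Finset.mem_erase.mp hx
    obtain ⟨hxΦ, c, hc⟩ := (hP x).mp hx
    have := aux_refl_pos D j x hxΦ c hc hne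
    exact Finset.mem_erase.mpr ⟨this.2, (hP _).mpr this.1⟩
  have hsum : ∑ x ∈ P.erase (D.α j), ⟪x, D.α j⟫ = ∑ x ∈ P.erase (D.α j), -⟪x, D.α j⟫ := by
    refine Finset.sum_bij' (fun x _ => s x) (fun x _ => s x) hsP hsP
      (fun x _ => hss x) (fun x _ => hss x) ?_
    intro x _
    rw [hsin, neg_neg]
  rw [Finset.sum_neg_distrib] at hsum
  rw [hρ, real_inner_smul_left, sum_inner, ← Finset.add_sum_erase P _ hjP]
  linarith

theorem aux_main (D : RootSystemData E)
    (i : Fin D.r) (hlong : ⟪D.α i, D.α i⟫ = 2) (hθ1 : ⟪D.fw i, D.θ⟫ = 1)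
    (τ : E ≃ₗ[ℝ] E) (hτW : τ ∈ weylGroup D)
    (hτi : τ (D.α i) = -D.θ)
    (hτj : ∀ j, j ≠ i → ∃ j', j' ≠ i ∧ τ (D.α j) = D.α j') :
    2 * ⟪D.ρ, D.fw i⟫ = (⟪D.ρ, D.θ⟫ + 1) * ⟪D.fw i, D.fw i⟫ := by
  have iso := aux_isometry D τ hτW
  have hsurj : ∀ k, k ≠ i → ∃ j, τ (D.α j) = D.α k := by
    choose f hf using hτj
    let g : {j // j ≠ i} → {j // j ≠ i} := fun j => ⟨f j.1 j.2, (hf j.1 j.2).1⟩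
    have hg : Function.Injective g := by
      intro a b hab
      have h1 : f a.1 a.2 = f b.1 b.2 := congrArg Subtype.val hab
      have h2 : τ (D.α a.1) = τ (D.α b.1) := by
        rw [(hf a.1 a.2).2, (hf b.1 b.2).2, h1]
      exact Subtype.ext (D.base_indep.injective (τ.injective h2))
    intro k hk
    obtain ⟨j, hj⟩ := (Finite.injective_iff_surjective.mp hg) ⟨k, hk⟩
    refine ⟨j.1, ?_⟩
    rw [(hf j.1 j.2).2]
    exact congrArg D.α (congrArg Subtype.val hj)
  have horth : ∀ k, k ≠ i → ⟪τ D.ρ, D.α k⟫ = ⟪D.ρ, D.α k⟫ := by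
    intro k hk
    obtain ⟨j, hj⟩ := hsurj k hk
    rw [aux_rho D k, ← hj, iso, iso, aux_rho D j]
  obtain ⟨c, hc⟩ : ∃ c : ℝ, τ D.ρ = D.ρ + c • D.fw i := by
    refine ⟨⟪τ D.ρ - D.ρ, D.α i⟫, ?_⟩
    rw [← sub_eq_zero]
    apply aux_ext D
    intro k
    rw [inner_sub_left, inner_add_left, real_inner_smul_left, D.fw_def]
    by_cases hk : i = k
    · subst hk
      rw [if_pos rfl, hlong, inner_sub_left]
      ring
    · rw [if_neg hk, horth k (Ne.symm hk)]
      ring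
  have hθ : ⟪τ D.ρ, D.θ⟫ = -1 := by
    have h := iso D.ρ (D.α i)
    rw [hτi, inner_neg_right, aux_rho D i, hlong] at h
    linarith
  have hcval : c = -(⟪D.ρ, D.θ⟫ + 1) := by
    rw [hc, inner_add_left, real_inner_smul_left, hθ1] at hθ
    linarith
  have hpos : 0 ≤ ⟪D.ρ, D.θ⟫ := by
    obtain ⟨d, hd⟩ := D.θ_pos
    rw [hd, inner_sum]
    apply Finset.sum_nonneg
    intro k _
    rw [real_inner_smul_right, aux_rho D k]
    have := real_inner_self_nonneg (x := D.α k)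
    positivity
  have hnorm := iso D.ρ D.ρ
  rw [hc] at hnorm
  simp only [inner_add_left, inner_add_right, real_inner_smul_left, real_inner_smul_right]
    at hnorm
  rw [real_inner_comm D.ρ (D.fw i)] at hnorm
  have hc0 : c ≠ 0 := by rw [hcval]; linarith
  have h2 : c * (2 * ⟪D.ρ, D.fw i⟫ + c * ⟪D.fw i, D.fw i⟫) = 0 := by linarith
  have h3 := (mul_eq_zero.mp h2).resolve_left hc0
  rw [hcval] at h3
  linarith

/-- `2(ρ,λᵢ) = h(λᵢ,λᵢ)`; consequently `(kλᵢ, kλᵢ+2ρ) = k(k+h)(λᵢ,λᵢ)` for every real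
`k`, and if `k + h ≠ 0` then `exp(πi(kλᵢ,kλᵢ+2ρ)/(k+h)) = exp(πi·k(λᵢ,λᵢ))`, which is
`1` or `−1` according to whether `k(λᵢ,λᵢ)` is an even or an odd integer. -/
theorem statement12 (D : RootSystemData E)
    (i : Fin D.r) (hlong : ⟪D.α i, D.α i⟫ = 2) (hθ1 : ⟪D.fw i, D.θ⟫ = 1)
    (τ : E ≃ₗ[ℝ] E) (hτW : τ ∈ weylGroup D)
    (hτi : τ (D.α i) = -D.θ)
    (hτj : ∀ j, j ≠ i → ∃ j', j' ≠ i ∧ τ (D.α j) = D.α j')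
 :
    2 * ⟪D.ρ, D.fw i⟫ = (⟪D.ρ, D.θ⟫ + 1) * ⟪D.fw i, D.fw i⟫ ∧
    ∀ k : ℝ,
      ⟪k • D.fw i, k • D.fw i + (2 : ℝ) • D.ρ⟫
        = k * (k + (⟪D.ρ, D.θ⟫ + 1)) * ⟪D.fw i, D.fw i⟫ ∧
      (k + (⟪D.ρ, D.θ⟫ + 1) ≠ 0 →
        Complex.exp ((Real.pi : ℂ) * Complex.I *
            ((⟪k • D.fw i, k • D.fw i + (2 : ℝ) • D.ρ⟫ / (k + (⟪D.ρ, D.θ⟫ + 1)) : ℝ) : ℂ))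
          = Complex.exp ((Real.pi : ℂ) * Complex.I * ((k * ⟪D.fw i, D.fw i⟫ : ℝ) : ℂ)) ∧
        ∀ n : ℤ, k * ⟪D.fw i, D.fw i⟫ = (n : ℝ) →
          Complex.exp ((Real.pi : ℂ) * Complex.I *
              ((⟪k • D.fw i, k • D.fw i + (2 : ℝ) • D.ρ⟫ / (k + (⟪D.ρ, D.θ⟫ + 1)) : ℝ) : ℂ))
            = if Even n then 1 else -1) := by
  have hm := aux_main D i hlong hθ1 τ hτW hτi hτj
  refine ⟨hm, fun k => ?_⟩
  have h1 : ⟪k • D.fw i, k • D.fw i + (2 : ℝ) • D.ρ⟫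
        = k * (k + (⟪D.ρ, D.θ⟫ + 1)) * ⟪D.fw i, D.fw i⟫ := by
    simp only [inner_add_right, real_inner_smul_left, real_inner_smul_right]
    rw [real_inner_comm D.ρ (D.fw i)]
    linear_combination k * hm
  refine ⟨h1, fun hk => ?_⟩
  have h2 : ⟪k • D.fw i, k • D.fw i + (2 : ℝ) • D.ρ⟫ / (k + (⟪D.ρ, D.θ⟫ + 1))
      = k * ⟪D.fw i, D.fw i⟫ := by
    rw [h1]; field_simp
  rw [h2]
  refine ⟨rfl, fun n hn => ?_⟩
  rw [hn]
  have h3 : (Real.pi : ℂ) * Complex.I * ((n : ℝ) : ℂ) = (n : ℂ) * (Real.pi * Complex.I) := by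
    push_cast; ring
  rw [h3, Complex.exp_int_mul, Complex.exp_pi_mul_I]
  split_ifs with he
  · exact he.neg_one_zpow
  · exact (Int.not_even_iff_odd.mp he).neg_one_zpow
end
end
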